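/- Let d ≥ 1 be an integer and let j(x) = ∫₀^∞ (4πs)^{-d/2} exp(-‖x‖²/(4s)) e^{-s} s^{-1} ds for x ∈ ℝ^d \ {0}. Then ‖x‖^{(d+1)/2} e^{‖x‖} j(x) tends to 2^{(1-d)/2} π^{-(d-1)/2} as ‖x‖ → ∞. -/

import Mathlib

open MeasureTheory Real Filter

/-- The rescaled hyperbolic sine `a * sinh (w / (2 * a))` tends to `w / 2` as `a → ∞`. -/
theorem tendsto_mul_sinh_div_atTop (w : ℝ) :
    Tendsto (fun a : ℝ => a * sinh (w / (2 * a))) atTop (nhds (w / 2)) := by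
  have h : HasDerivAt (fun x : ℝ => sinh (w / 2 * x)) (w / 2) 0 := by
    simpa using ((hasDerivAt_id (0 : ℝ)).const_mul (w / 2)).sinh
  have h' := h.tendsto_slope_zero_right.comp tendsto_inv_atTop_nhdsGT_zero
  refine h'.congr' ?_
  filter_upwards [eventually_gt_atTop 0] with a ha
  have : w / 2 * a⁻¹ = w / (2 * a) := by field_simp
  simp [this]

/-- `|w| / 2 ≤ |a * sinh (w / (2 * a))|` in squared form. -/
theorem sq_div_two_le_two_mul_sq_mul_sinh {a : ℝ} (ha : 0 < a) (w : ℝ) :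
    w ^ 2 / 2 ≤ 2 * (a * sinh (w / (2 * a))) ^ 2 := by
  have h : |w / (2 * a)| ≤ |sinh (w / (2 * a))| := by
    rw [abs_sinh]
    exact self_le_sinh_iff.2 (abs_nonneg _)
  have h2 := mul_le_mul_of_nonneg_left (sq_le_sq.2 h) (sq_nonneg a)
  have h3 : a ^ 2 * (w / (2 * a)) ^ 2 = w ^ 2 / 4 := by field_simp; norm_num
  rw [h3] at h2
  linarith [mul_pow a (sinh (w / (2 * a))) 2]

/-- Laplace's method for the rescaled integral representation of the Macdonald function. -/
theorem tendsto_integral_exp_mul_exp_neg_sinh_sq (ν : ℝ) :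
    Tendsto (fun a : ℝ =>
        ∫ w : ℝ, exp (-ν * (w / a)) * exp (-(2 * (a * sinh (w / (2 * a))) ^ 2)))
      atTop (nhds (√(2 * π))) := by
  have hlim : ∫ w : ℝ, exp (-(1 / 2) * w ^ 2) = √(2 * π) := by
    rw [integral_gaussian]
    congr 1
    ring
  rw [← hlim]
  refine tendsto_integral_filter_of_dominated_convergence
    (fun w => exp (ν ^ 2) * exp (-(1 / 4) * w ^ 2)) ?_ ?_ ?_ ?_
  · exact Eventually.of_forall fun a => by
      apply Measurable.aestronglyMeasurable
      fun_prop
  · filter_upwards [eventually_ge_atTop 1] with a ha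
    refine Eventually.of_forall fun w => ?_
    rw [← exp_add, ← exp_add, norm_of_nonneg (exp_nonneg _)]
    apply exp_le_exp.2
    have h1 := sq_div_two_le_two_mul_sq_mul_sinh (by linarith : 0 < a) w
    have h2 : (w / a) ^ 2 ≤ w ^ 2 := by
      rw [div_pow]
      exact div_le_self (sq_nonneg w) (one_le_pow₀ ha)
    nlinarith [sq_nonneg (ν + w / a / 2)]
  · exact (integrable_exp_neg_mul_sq (by norm_num)).const_mul _
  · refine Eventually.of_forall fun w => ?_
    have h1 : Tendsto (fun a : ℝ => exp (-ν * (w / a))) atTop (nhds 1) := by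
      simpa using ((tendsto_id.const_div_atTop w).const_mul (-ν)).rexp
    have h2 := ((((tendsto_mul_sinh_div_atTop w).pow 2).const_mul 2).neg).rexp
    convert h1.mul h2 using 2
    rw [one_mul]
    congr 1
    ring

/-- The substitution `s = (a ^ 2 / 2) * exp (w / a)` in an integral over the half-line. -/
theorem integral_Ioi_eq_integral_exp_div {a : ℝ} (ha : 0 < a) (f : ℝ → ℝ) :
    ∫ s in Set.Ioi (0 : ℝ), f s =
      ∫ w : ℝ, a / 2 * exp (w / a) * f (a ^ 2 / 2 * exp (w / a)) := by
  have himage : (fun w : ℝ => a ^ 2 / 2 * exp (w / a)) '' Set.univ = Set.Ioi 0 := by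
    ext s
    simp only [Set.image_univ, Set.mem_range, Set.mem_Ioi]
    constructor
    · rintro ⟨w, rfl⟩
      positivity
    · intro hs
      refine ⟨a * log (2 * s / a ^ 2), ?_⟩
      rw [mul_div_cancel_left₀ _ ha.ne', exp_log (by positivity)]
      field_simp
  have hderiv : ∀ w ∈ Set.univ, HasDerivWithinAt (fun w : ℝ => a ^ 2 / 2 * exp (w / a))
      (a / 2 * exp (w / a)) Set.univ w := fun w _ => by
    have h := (((hasDerivAt_id w).div_const a).exp.const_mul (a ^ 2 / 2)).hasDerivWithinAt
      (s := Set.univ)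
    refine h.congr_deriv ?_
    simp only [id]
    field_simp
  have hinj : Set.InjOn (fun w : ℝ => a ^ 2 / 2 * exp (w / a)) Set.univ := by
    intro x _ y _ hxy
    have h := exp_injective (mul_left_cancel₀ (by positivity : a ^ 2 / 2 ≠ 0) hxy)
    exact (div_left_inj' ha.ne').1 h
  rw [← himage, integral_image_eq_integral_abs_deriv_smul MeasurableSet.univ hderiv hinj,
    setIntegral_univ]
  refine integral_congr_ae (Eventually.of_forall fun w => ?_)
  simp only [smul_eq_mul]
  rw [abs_of_pos (by positivity)]

/-- The variance gamma Lévy density at radius `a ^ 2`, normalised by its large-space decay. -/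
theorem variance_gamma_integral_rescaled (ν : ℝ) {a : ℝ} (ha : 0 < a) :
    (a ^ 2) ^ (ν + 1 / 2) * exp (a ^ 2) *
        ∫ s in Set.Ioi (0 : ℝ),
          (4 * π * s) ^ (-ν) * exp (-(a ^ 2) ^ 2 / (4 * s)) * exp (-s) * s⁻¹ =
      (2 * π) ^ (-ν) *
        ∫ w : ℝ, exp (-ν * (w / a)) * exp (-(2 * (a * sinh (w / (2 * a))) ^ 2)) := by
  rw [integral_Ioi_eq_integral_exp_div ha, ← integral_const_mul, ← integral_const_mul]
  refine integral_congr_ae (Eventually.of_forall fun w => ?_)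
  have hpow : (4 * π * (a ^ 2 / 2 * exp (w / a))) ^ (-ν) =
      (2 * π) ^ (-ν) * (a ^ 2) ^ (-ν) * exp (-ν * (w / a)) := by
    rw [show 4 * π * (a ^ 2 / 2 * exp (w / a)) = 2 * π * a ^ 2 * exp (w / a) by ring,
      mul_rpow (by positivity) (exp_nonneg _), mul_rpow (by positivity) (by positivity),
      ← exp_mul, mul_comm (w / a)]
  have hroot : (a ^ 2) ^ (ν + 1 / 2) = (a ^ 2) ^ ν * a := by
    rw [rpow_add (by positivity), ← sqrt_eq_rpow, sqrt_sq ha.le]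
  have hcancel : (a ^ 2) ^ ν * (a ^ 2) ^ (-ν) = 1 := by
    rw [← rpow_add (by positivity), add_neg_cancel, rpow_zero]
  have hsq : exp (w / a) = exp (w / (2 * a)) ^ 2 := by
    rw [← exp_nat_mul]
    congr 1
    field_simp
    norm_num
  have hexp : exp (a ^ 2) * exp (-(a ^ 2) ^ 2 / (4 * (a ^ 2 / 2 * exp (w / a)))) *
      exp (-(a ^ 2 / 2 * exp (w / a))) = exp (-(2 * (a * sinh (w / (2 * a))) ^ 2)) := by
    rw [← exp_add, ← exp_add, hsq, sinh_eq, exp_neg (w / (2 * a))]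
    congr 1
    have := (exp_pos (w / (2 * a))).ne'
    field_simp
    ring
  have hs : a * (a / 2 * exp (w / a)) * (a ^ 2 / 2 * exp (w / a))⁻¹ = 1 := by
    field_simp
  simp only []
  rw [hpow, hroot, ← hexp]
  generalize exp (-(a ^ 2) ^ 2 / (4 * (a ^ 2 / 2 * exp (w / a)))) = A
  generalize exp (-(a ^ 2 / 2 * exp (w / a))) = B
  generalize (a ^ 2 / 2 * exp (w / a))⁻¹ = C at *
  linear_combination
    ((2 * π) ^ (-ν) * exp (-ν * (w / a)) * exp (a ^ 2) * A * B) * hcancel +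
    ((2 * π) ^ (-ν) * exp (-ν * (w / a)) * exp (a ^ 2) * A * B) *
      ((a ^ 2) ^ ν * (a ^ 2) ^ (-ν)) * hs

open MeasureTheory Real Filter

/-- Large-space asymptotics of the Lévy density of the variance gamma (geometric
2-stable) process in dimension `d`: `‖x‖^{(d+1)/2} e^{‖x‖} j(x) → 2^{(1-d)/2} π^{-(d-1)/2}`
as `‖x‖ → ∞`, where `j(x) = ∫₀^∞ (4πs)^{-d/2} e^{-‖x‖²/(4s)} e^{-s} s⁻¹ ds`. -/
theorem variance_gamma_levy_density_large_space {d : ℕ} (hd : 1 ≤ d) :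
    Tendsto (fun x : EuclideanSpace ℝ (Fin d) =>
        ‖x‖ ^ (((d : ℝ) + 1) / 2) * Real.exp ‖x‖ *
          ∫ s in Set.Ioi (0 : ℝ),
            (4 * π * s) ^ (-(d : ℝ) / 2) * Real.exp (-‖x‖ ^ 2 / (4 * s)) *
              Real.exp (-s) * s⁻¹)
      (comap norm atTop)
      (nhds ((2 : ℝ) ^ ((1 - (d : ℝ)) / 2) * π ^ (-((d : ℝ) - 1) / 2))) := by
  have hlim := ((tendsto_integral_exp_mul_exp_neg_sinh_sq ((d : ℝ) / 2)).const_mul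
    ((2 * π) ^ (-((d : ℝ) / 2)))).comp
      (tendsto_sqrt_atTop.comp (tendsto_comap (f := fun x : EuclideanSpace ℝ (Fin d) => ‖x‖)))
  have hconst : (2 : ℝ) ^ ((1 - (d : ℝ)) / 2) * π ^ (-((d : ℝ) - 1) / 2) =
      (2 * π) ^ (-((d : ℝ) / 2)) * √(2 * π) := by
    rw [sqrt_eq_rpow, ← rpow_add (by positivity), neg_sub,
      ← mul_rpow (by positivity) pi_pos.le]
    congr 1
    ring
  rw [hconst]
  refine hlim.congr' ?_
  filter_upwards [tendsto_comap.eventually (eventually_gt_atTop (0 : ℝ))] with x hx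
  have h := variance_gamma_integral_rescaled ((d : ℝ) / 2) (sqrt_pos.2 hx)
  rw [sq_sqrt hx.le] at h
  simp only [Function.comp_apply]
  rw [← h, add_div, neg_div]
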